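/- Suppose X₁(0,0) ≠ 0. Let u be analytic in a neighborhood of (0,0) and satisfy X(u) = B₀·u + B₁ in a neighborhood of (0,0). Then there exists a first integral ω of X at (0,0) such that ∂₂ω is nonvanishing in a neighborhood of (0,0) and ∂₂²ω = u·∂₂ω in that neighborhood (i.e., ∂₂²ω/∂₂ω = u). -/

import Mathlib

open Filter MvPolynomial

/-- Evaluation of a polynomial in two variables at a point of `ℂ × ℂ`. -/
noncomputable def pev (P : MvPolynomial (Fin 2) ℂ) (p : ℂ × ℂ) : ℂ :=
  MvPolynomial.eval ![p.1, p.2] P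

/-- Partial derivative with respect to the first variable. -/
noncomputable def d1 : (ℂ × ℂ → ℂ) → (ℂ × ℂ → ℂ) :=
  fun f p => deriv (fun x => f (x, p.2)) p.1

/-- Partial derivative with respect to the second variable. -/
noncomputable def d2 : (ℂ × ℂ → ℂ) → (ℂ × ℂ → ℂ) :=
  fun f p => deriv (fun y => f (p.1, y)) p.2

/-- The differential operator `X(g) = X₁·∂₁g + X₂·∂₂g`. -/
noncomputable def Xop (X₁ X₂ : MvPolynomial (Fin 2) ℂ) (f : ℂ × ℂ → ℂ) : ℂ × ℂ → ℂ :=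
  fun p => pev X₁ p * d1 f p + pev X₂ p * d2 f p

/-- A first integral of `X` at `p`: a nonconstant function, analytic near `p`,
annihilated by `X` near `p`. -/
def IsFirstIntegralAt (X₁ X₂ : MvPolynomial (Fin 2) ℂ) (ω : ℂ × ℂ → ℂ) (p : ℂ × ℂ) : Prop :=
  AnalyticAt ℂ ω p ∧ (∀ᶠ q in nhds p, Xop X₁ X₂ ω q = 0) ∧
    ¬ ∃ c : ℂ, ∀ᶠ q in nhds p, ω q = c

/-- The functions `Bᵢ = −X₁·∂₂^{i+1}(X₂/X₁)`. -/
noncomputable def B (X₁ X₂ : MvPolynomial (Fin 2) ℂ) (i : ℕ) : ℂ × ℂ → ℂ :=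
  fun p => -(pev X₁ p) * (d2^[i + 1] (fun q => pev X₂ q / pev X₁ q)) p

open Topology in
/-- A function whose Fréchet derivative is analytic at a point is itself analytic there. -/
theorem analyticAt_of_eventually_hasFDerivAt {E F : Type*} [NormedAddCommGroup E]
    [NormedSpace ℂ E] [NormedAddCommGroup F] [NormedSpace ℂ F] [CompleteSpace F]
    {A : E → E →L[ℂ] F} {v : E → F} {x : E} (hA : AnalyticAt ℂ A x)
    (hv : ∀ᶠ y in 𝓝 x, HasFDerivAt v (A y) y) : AnalyticAt ℂ v x := by
  obtain ⟨p, r, hp⟩ := hA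
  obtain ⟨ε, hε, hvε⟩ := EMetric.mem_nhds_iff.1 hv
  replace hp := hp.mono (lt_min hp.r_pos hε) (min_le_left r ε)
  replace hvε : ∀ y ∈ Metric.eball x (min r ε), HasFDerivAt v (A y) y := fun y hy ↦
    hvε (Metric.eball_subset_eball (min_le_right _ _) hy)
  generalize min r ε = s at hp hvε
  let q : FormalMultilinearSeries ℂ E F := fun n ↦ (n : ℂ)⁻¹ • p.unshift 0 n
  have hq : s ≤ q.radius := by
    refine hp.r_le.trans ?_
    rw [← p.radius_unshift 0]
    refine ENNReal.le_of_forall_nnreal_lt fun ρ hρ ↦ ?_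
    obtain ⟨C, -, hC⟩ := (p.unshift 0).norm_mul_pow_le_of_lt_radius hρ
    refine q.le_radius_of_bound C fun n ↦ le_trans ?_ (hC n)
    gcongr
    rw [norm_smul]
    refine mul_le_of_le_one_left (norm_nonneg _) ?_
    rw [norm_inv, Complex.norm_natCast]
    exact Nat.cast_inv_le_one n
  have hdiag (n : ℕ) (y : E) : q.derivSeries n (fun _ ↦ y) y = p n (fun _ ↦ y) y := by
    rw [q.derivSeries_apply_diag]
    have h : p.unshift 0 (n + 1) (fun _ ↦ y) = p n (fun _ ↦ y) y := rfl
    simp only [q, smul_apply, h]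
    rw [← Nat.cast_smul_eq_nsmul ℂ, smul_smul, mul_inv_cancel₀ (Nat.cast_ne_zero.2 n.succ_ne_zero), one_smul]
  have hqs : HasFPowerSeriesOnBall q.sum q 0 s :=
    (q.hasFPowerSeriesOnBall (hp.r_pos.trans_le hq)).mono hp.r_pos hq
  have hline (t : ℂ) (y : E) (hty : t • y ∈ Metric.eball (0 : E) s) :
      fderiv ℂ q.sum (t • y) y = A (x + t • y) y := by
    have h₁ := ((hqs.fderiv.hasSum hty).mapL (ContinuousLinearMap.apply ℂ F y))
    have h₂ := ((hp.hasSum hty).mapL (ContinuousLinearMap.apply ℂ F y))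
    simp only [zero_add, ContinuousLinearMap.apply_apply] at h₁ h₂
    refine h₁.unique (h₂.congr_fun ?_)
    intro n
    have e₁ := (q.derivSeries n).map_smul_univ (fun _ ↦ t) (fun _ ↦ y)
    have e₂ := (p n).map_smul_univ (fun _ ↦ t) (fun _ ↦ y)
    rw [e₁, e₂]
    simp [hdiag]
  have hqz : q.sum 0 = 0 := by
    have h := hqs.coeff_zero (fun _ ↦ 0)
    rw [← h]
    simp [q]
  have key : ∀ z ∈ Metric.eball x s, v z = v x + q.sum (z - x) := by
    intro z hz
    set y := z - x with hy
    have hseg : ∀ t ∈ Set.Icc (0 : ℝ) 1, (t : ℂ) • y ∈ Metric.eball (0 : E) s := by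
      intro t ht
      rw [Metric.mem_eball, edist_zero_right]
      rw [Metric.mem_eball, edist_eq_enorm_sub, ← hy] at hz
      refine lt_of_le_of_lt ?_ hz
      rw [enorm_le_iff_norm_le, norm_smul]
      refine mul_le_of_le_one_left (norm_nonneg _) ?_
      rw [Complex.norm_real, Real.norm_of_nonneg ht.1]
      exact ht.2
    have hd : ∀ t ∈ Set.Icc (0 : ℝ) 1,
        HasDerivAt (fun t : ℝ ↦ v (x + (t : ℂ) • y) - q.sum ((t : ℂ) • y)) 0 t := by
      intro t ht
      have hm := hseg t ht
      have hl : HasDerivAt (fun t : ℂ ↦ t • y) y (t : ℂ) := by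
        simpa using (hasDerivAt_id (t : ℂ)).smul_const y
      have h₁ : HasDerivAt (fun t : ℂ ↦ v (x + t • y)) (A (x + (t : ℂ) • y) y) (t : ℂ) :=
        (hvε _ (by simpa [edist_eq_enorm_sub] using hm)).comp_hasDerivAt (t : ℂ) (hl.const_add x)
      have h₂ : HasDerivAt (fun t : ℂ ↦ q.sum (t • y)) (fderiv ℂ q.sum ((t : ℂ) • y) y) (t : ℂ) :=
        HasFDerivAt.comp_hasDerivAt (f := fun t : ℂ ↦ t • y) (t : ℂ)
          (hqs.analyticAt_of_mem hm).differentiableAt.hasFDerivAt hl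
      have h₃ := h₁.fun_sub h₂
      rw [hline t y hm, sub_self] at h₃
      simpa using! HasDerivAt.scomp t h₃ Complex.ofRealCLM.hasDerivAt
    have hc := constant_of_has_deriv_right_zero
      (fun t ht ↦ (hd t ht).continuousAt.continuousWithinAt)
      (fun t ht ↦ (hd t (Set.Ico_subset_Icc_self ht)).hasDerivWithinAt) 1 (by simp)
    simp only [Complex.ofReal_one, one_smul, Complex.ofReal_zero, zero_smul, add_zero, hqz,
      sub_zero] at hc
    rw [← hc, hy]
    simp
  have han : AnalyticAt ℂ (fun z ↦ v x + q.sum (z - x)) x := by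
    have h : AnalyticAt ℂ q.sum (x - x) := by simpa using hqs.analyticAt
    exact analyticAt_const.add (AnalyticAt.fun_comp (f := fun z ↦ z - x) h (analyticAt_id.sub analyticAt_const))
  exact han.congr (Filter.eventuallyEq_of_mem (Metric.eball_mem_nhds x hp.r_pos)
    fun z hz ↦ (key z hz).symm)

theorem d1_eq_fderiv {f : ℂ × ℂ → ℂ} {p : ℂ × ℂ} (hf : DifferentiableAt ℂ f p) :
    d1 f p = fderiv ℂ f p (1, 0) :=
  (HasFDerivAt.comp_hasDerivAt (f := fun x : ℂ ↦ (x, p.2)) p.1 hf.hasFDerivAt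
    ((hasDerivAt_id p.1).prodMk (hasDerivAt_const p.1 p.2))).deriv

theorem d2_eq_fderiv {f : ℂ × ℂ → ℂ} {p : ℂ × ℂ} (hf : DifferentiableAt ℂ f p) :
    d2 f p = fderiv ℂ f p (0, 1) :=
  (HasFDerivAt.comp_hasDerivAt (f := fun y : ℂ ↦ (p.1, y)) p.2 hf.hasFDerivAt
    ((hasDerivAt_const p.2 p.1).prodMk (hasDerivAt_id p.2))).deriv

theorem analyticAt_d2 {f : ℂ × ℂ → ℂ} {p : ℂ × ℂ} (hf : AnalyticAt ℂ f p) :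
    AnalyticAt ℂ (d2 f) p := by
  refine (AnalyticAt.fun_comp ((ContinuousLinearMap.apply ℂ ℂ ((0 : ℂ), (1 : ℂ))).analyticAt _)
    hf.fderiv).congr ?_
  filter_upwards [hf.eventually_analyticAt] with q hq
  exact (d2_eq_fderiv hq.differentiableAt).symm

theorem Filter.EventuallyEq.d2_eq {f g : ℂ × ℂ → ℂ} {p : ℂ × ℂ} (h : f =ᶠ[nhds p] g) :
    d2 f p = d2 g p :=
  Filter.EventuallyEq.deriv_eq <|
    (Continuous.prodMk_right p.1).continuousAt (x := p.2) |>.eventually h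

theorem analyticAt_pev (P : MvPolynomial (Fin 2) ℂ) (p : ℂ × ℂ) : AnalyticAt ℂ (pev P) p := by
  have h : AnalyticAt ℂ (fun q : ℂ × ℂ ↦ MvPolynomial.aeval ![q.1, q.2] P) p := by
    refine AnalyticAt.aeval_mvPolynomial (fun i ↦ ?_) P
    fin_cases i
    · exact analyticAt_fst
    · exact analyticAt_snd
  exact h

/-- The Poincaré lemma for analytic closed `1`-forms in two complex variables. -/
theorem exists_analyticAt_d1_d2_eq {a b : ℂ × ℂ → ℂ} {p : ℂ × ℂ} (ha : AnalyticAt ℂ a p)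
    (hb : AnalyticAt ℂ b p) (h : ∀ᶠ q in nhds p, d2 a q = d1 b q) :
    ∃ v : ℂ × ℂ → ℂ, AnalyticAt ℂ v p ∧ ∀ᶠ q in nhds p, d1 v q = a q ∧ d2 v q = b q := by
  let A : ℂ × ℂ → ℂ × ℂ →L[ℂ] ℂ := fun q ↦
    a q • ContinuousLinearMap.fst ℂ ℂ ℂ + b q • ContinuousLinearMap.snd ℂ ℂ ℂ
  have hA : AnalyticAt ℂ A p := (ha.smul analyticAt_const).add (hb.smul analyticAt_const)
  obtain ⟨ε, hε, hball⟩ := Metric.eventually_nhds_iff_ball.1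
    (h.and (ha.eventually_analyticAt.and hb.eventually_analyticAt))
  have hd : ∀ q ∈ Metric.ball p ε, HasFDerivAt A
      ((fderiv ℂ a q).smulRight (ContinuousLinearMap.fst ℂ ℂ ℂ) +
        (fderiv ℂ b q).smulRight (ContinuousLinearMap.snd ℂ ℂ ℂ)) q := fun q hq ↦
    ((hball q hq).2.1.differentiableAt.hasFDerivAt.smul_const (ContinuousLinearMap.fst ℂ ℂ ℂ)).add
      ((hball q hq).2.2.differentiableAt.hasFDerivAt.smul_const (ContinuousLinearMap.snd ℂ ℂ ℂ))
  obtain ⟨v, hv⟩ := (convex_ball p ε).exists_forall_hasFDerivAt_of_fderiv_symmetric (ω := A)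
    Metric.isOpen_ball
    (fun q hq ↦ ((hd q hq).restrictScalars ℝ).differentiableAt.differentiableWithinAt) (by
      intro q hq x y
      obtain ⟨hc, hqa, hqb⟩ := hball q hq
      rw [d2_eq_fderiv hqa.differentiableAt, d1_eq_fderiv hqb.differentiableAt] at hc
      rw [((hd q hq).restrictScalars ℝ).fderiv]
      have hexp (L : ℂ × ℂ →L[ℂ] ℂ) (z : ℂ × ℂ) : L z = z.1 * L (1, 0) + z.2 * L (0, 1) := by
        rw [← smul_eq_mul, ← smul_eq_mul, ← map_smul, ← map_smul, ← map_add]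
        simp
      simp only [ContinuousLinearMap.coe_restrictScalars', add_apply,
        ContinuousLinearMap.smulRight_apply, smul_apply,
        ContinuousLinearMap.coe_fst', ContinuousLinearMap.coe_snd', smul_eq_mul]
      rw [hexp (fderiv ℂ a q) x, hexp (fderiv ℂ a q) y, hexp (fderiv ℂ b q) x,
        hexp (fderiv ℂ b q) y, hc]
      ring)
  have hv' : ∀ᶠ q in nhds p, HasFDerivAt v (A q) q :=
    Filter.eventually_of_mem (Metric.ball_mem_nhds p hε) hv
  refine ⟨v, analyticAt_of_eventually_hasFDerivAt hA hv', ?_⟩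
  filter_upwards [hv'] with q hq
  rw [d1_eq_fderiv hq.differentiableAt, d2_eq_fderiv hq.differentiableAt, hq.fderiv]
  simp [A]

theorem d1_cexp {v : ℂ × ℂ → ℂ} {p : ℂ × ℂ} (hv : DifferentiableAt ℂ v p) :
    d1 (fun q ↦ Complex.exp (v q)) p = Complex.exp (v p) * d1 v p := by
  rw [d1_eq_fderiv hv.cexp, d1_eq_fderiv hv, hv.hasFDerivAt.cexp.fderiv]
  simp

theorem d2_cexp {v : ℂ × ℂ → ℂ} {p : ℂ × ℂ} (hv : DifferentiableAt ℂ v p) :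
    d2 (fun q ↦ Complex.exp (v q)) p = Complex.exp (v p) * d2 v p := by
  rw [d2_eq_fderiv hv.cexp, d2_eq_fderiv hv, hv.hasFDerivAt.cexp.fderiv]
  simp

theorem d2_neg_mul {f g : ℂ × ℂ → ℂ} {p : ℂ × ℂ} (hf : DifferentiableAt ℂ f p)
    (hg : DifferentiableAt ℂ g p) :
    d2 (fun q ↦ -(f q * g q)) p = -(d2 f p * g p + f p * d2 g p) := by
  change d2 (-(f * g)) p = _
  rw [d2_eq_fderiv (hf.mul hg).neg, d2_eq_fderiv hf, d2_eq_fderiv hg,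
    (hf.hasFDerivAt.mul hg.hasFDerivAt).neg.fderiv]
  simp
  ring

theorem d2_neg_mul_add {f g k : ℂ × ℂ → ℂ} {p : ℂ × ℂ} (hf : DifferentiableAt ℂ f p)
    (hg : DifferentiableAt ℂ g p) (hk : DifferentiableAt ℂ k p) :
    d2 (fun q ↦ -(f q * g q + k q)) p = -(d2 f p * g p + f p * d2 g p + d2 k p) := by
  change d2 (-(f * g + k)) p = _
  rw [d2_eq_fderiv ((hf.mul hg).add hk).neg, d2_eq_fderiv hf, d2_eq_fderiv hg, d2_eq_fderiv hk,
    ((hf.hasFDerivAt.mul hg.hasFDerivAt).add hk.hasFDerivAt).neg.fderiv]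
  simp
  ring

/-- an analytic solution of `X(u) = B₀·u + B₁` near `(0,0)` is
`∂₂²ω/∂₂ω` for a first integral `ω` of `X` at `(0,0)`. -/
theorem stmt_12 (X₁ X₂ : MvPolynomial (Fin 2) ℂ)
    (hX₁ : pev X₁ ((0 : ℂ), (0 : ℂ)) ≠ 0)
    (u : ℂ × ℂ → ℂ) (hu : AnalyticAt ℂ u ((0 : ℂ), (0 : ℂ)))
    (hXu : ∀ᶠ q in nhds ((0 : ℂ), (0 : ℂ)),
      Xop X₁ X₂ u q = B X₁ X₂ 0 q * u q + B X₁ X₂ 1 q) :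
    ∃ ω : ℂ × ℂ → ℂ, IsFirstIntegralAt X₁ X₂ ω ((0 : ℂ), (0 : ℂ)) ∧
      (∀ᶠ q in nhds ((0 : ℂ), (0 : ℂ)), d2 ω q ≠ 0) ∧
      ∀ᶠ q in nhds ((0 : ℂ), (0 : ℂ)), d2^[2] ω q = u q * d2 ω q := by
  set p : ℂ × ℂ := (0, 0)
  set f : ℂ × ℂ → ℂ := fun q ↦ pev X₂ q / pev X₁ q with hf_def
  have hf : AnalyticAt ℂ f p := (analyticAt_pev X₂ p).div (analyticAt_pev X₁ p) hX₁
  have hne : ∀ᶠ q in nhds p, pev X₁ q ≠ 0 :=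
    (analyticAt_pev X₁ p).continuousAt.eventually_ne hX₁
  obtain ⟨v, hv, hdv⟩ := exists_analyticAt_d1_d2_eq
    (a := fun q ↦ -(f q * u q + d2 f q)) (b := u)
    ((hf.mul hu).add (analyticAt_d2 hf)).neg hu (by
      filter_upwards [hXu, hne, hf.eventually_analyticAt, hu.eventually_analyticAt]
        with q hq hq₁ hqf hqu
      rw [d2_neg_mul_add hqf.differentiableAt hqu.differentiableAt
        (analyticAt_d2 hqf).differentiableAt]
      have hX₂ : pev X₂ q = pev X₁ q * f q := (mul_div_cancel₀ _ hq₁).symm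
      simp only [Xop, B, zero_add, Function.iterate_succ, Function.iterate_zero,
        Function.comp_apply, id_eq, hX₂, ← hf_def] at hq
      refine mul_left_cancel₀ hq₁ ?_
      linear_combination -hq)
  set h : ℂ × ℂ → ℂ := fun q ↦ Complex.exp (v q) with hh_def
  have hh : AnalyticAt ℂ h p := hv.cexp
  obtain ⟨ω, hω, hdω⟩ := exists_analyticAt_d1_d2_eq (a := fun q ↦ -(f q * h q)) (b := h)
    (hf.mul hh).neg hh (by
      filter_upwards [hdv, hf.eventually_analyticAt, hv.eventually_analyticAt]
        with q hq hqf hqv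
      rw [d2_neg_mul hqf.differentiableAt hqv.differentiableAt.cexp, hh_def,
        d2_cexp hqv.differentiableAt, d1_cexp hqv.differentiableAt, hq.1, hq.2]
      ring)
  have hd2ω : ∀ᶠ q in nhds p, d2 ω q ≠ 0 := by
    filter_upwards [hdω] with q hq
    rw [hq.2]
    exact Complex.exp_ne_zero _
  refine ⟨ω, ⟨hω, ?_, ?_⟩, hd2ω, ?_⟩
  · filter_upwards [hdω, hne] with q hq hq₁
    simp only [Xop, hq.1, hq.2, hf_def]
    field_simp
    ring
  · rintro ⟨c, hc⟩
    refine hd2ω.self_of_nhds ?_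
    have hc' : ω =ᶠ[nhds p] fun _ ↦ c := hc
    rw [hc'.d2_eq]
    simp [d2]
  · filter_upwards [hdω.eventually_nhds, hdv, hv.eventually_analyticAt] with q hq hqv hv'
    have hω' : d2 ω =ᶠ[nhds q] h := hq.mono fun _ hz ↦ hz.2
    change d2 (d2 ω) q = _
    rw [hω'.d2_eq, hω'.self_of_nhds, hh_def, d2_cexp hv'.differentiableAt, hqv.2, mul_comm]
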